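/- arXiv:1511.00747 — 3 statements merged into one kernel-verified Lean document; each statement's English description precedes it below -/
import Mathlib

section
/- Let Φ : ℍ → V be holomorphic and satisfy the weight-2 automorphy law for π, and let F : ℍ → V be holomorphic with F′ = Φ on ℍ. Then for every γ ∈ Γ the function τ ↦ F(γ·τ) − π(γ)(F(τ)) is constant on ℍ. -/
open Matrix

/-- The upper half-plane, as a subset of `ℂ`. -/
def UH : Set ℂ := {z : ℂ | 0 < z.im}

/-- The Möbius action of `SL(2,ℝ)` on the upper half-plane. -/
noncomputable def moebius (γ : Matrix.SpecialLinearGroup (Fin 2) ℝ) (τ : ℂ) : ℂ :=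
  ((γ 0 0 : ℂ) * τ + (γ 0 1 : ℂ)) / ((γ 1 0 : ℂ) * τ + (γ 1 1 : ℂ))

/-- The automorphy factor `cτ + d`. -/
noncomputable def denom (γ : Matrix.SpecialLinearGroup (Fin 2) ℝ) (τ : ℂ) : ℂ :=
  (γ 1 0 : ℂ) * τ + (γ 1 1 : ℂ)

theorem isOpen_UH : IsOpen UH :=
  isOpen_lt continuous_const Complex.continuous_im

theorem isPreconnected_UH : IsPreconnected UH :=
  (convex_halfSpace_im_gt 0).isPreconnected

theorem moebius_mem_UH (γ : Matrix.SpecialLinearGroup (Fin 2) ℝ) {τ : ℂ} (hτ : τ ∈ UH) :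
    moebius γ τ ∈ UH := by
  have h := UpperHalfPlane.coe_specialLinearGroup_apply γ (⟨τ, hτ⟩ : UpperHalfPlane)
  have him : 0 < (γ • (⟨τ, hτ⟩ : UpperHalfPlane)).im := UpperHalfPlane.im_pos _
  rw [← UpperHalfPlane.coe_im, h] at him
  exact him

theorem denom_ne_zero_of_mem_UH (γ : Matrix.SpecialLinearGroup (Fin 2) ℝ) {τ : ℂ}
    (hτ : τ ∈ UH) : denom γ τ ≠ 0 :=
  UpperHalfPlane.denom_ne_zero (γ : GL (Fin 2) ℝ) ⟨τ, hτ⟩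

theorem hasDerivAt_moebius (γ : Matrix.SpecialLinearGroup (Fin 2) ℝ) {τ : ℂ} (hτ : τ ∈ UH) :
    HasDerivAt (moebius γ) ((denom γ τ ^ 2)⁻¹) τ := by
  have hlin (a b : ℂ) : HasDerivAt (fun z : ℂ ↦ a * z + b) a τ := by
    simpa using ((hasDerivAt_id τ).const_mul a).add_const b
  have hdet : (γ 0 0 : ℂ) * γ 1 1 - γ 0 1 * γ 1 0 = 1 := by
    exact_mod_cast (Matrix.det_fin_two γ.1).symm.trans γ.2
  have hd := denom_ne_zero_of_mem_UH γ hτ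
  unfold denom at hd ⊢
  refine ((hlin (γ 0 0) (γ 0 1)).fun_div (hlin (γ 1 0) (γ 1 1)) hd).congr_deriv ?_
  rw [inv_eq_one_div]
  congr 1
  linear_combination hdet

/-- if `Φ : ℍ → V` is holomorphic and satisfies the weight-2 automorphy
law for `π`, and `F : ℍ → V` is holomorphic with `F′ = Φ` on `ℍ`, then for every
`γ ∈ Γ` the function `τ ↦ F(γ·τ) − π(γ)(F(τ))` is constant on `ℍ`. -/
theorem antiderivative_of_weight_two_is_eichler_integral
    {V : Type*} [NormedAddCommGroup V] [NormedSpace ℂ V] [FiniteDimensional ℂ V]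
    (Γ : Subgroup (Matrix.SpecialLinearGroup (Fin 2) ℝ))
    (π : Γ →* (V ≃ₗ[ℂ] V))
    (Φ F : ℂ → V)
    (hΦhol : DifferentiableOn ℂ Φ UH)
    (hauto : ∀ γ : Γ, ∀ τ ∈ UH,
      ((denom ↑γ τ) ^ 2)⁻¹ • Φ (moebius ↑γ τ) = π γ (Φ τ))
    (hF : ∀ τ ∈ UH, HasDerivAt F (Φ τ) τ) :
    ∀ γ : Γ, ∀ τ₁ ∈ UH, ∀ τ₂ ∈ UH,
      F (moebius ↑γ τ₁) - π γ (F τ₁) = F (moebius ↑γ τ₂) - π γ (F τ₂) := by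
  intro γ τ₁ h₁ τ₂ h₂
  have hderiv (τ : ℂ) (hτ : τ ∈ UH) :
      HasDerivAt (fun z ↦ F (moebius γ z) - π γ (F z)) 0 τ := by
    have hπ : HasDerivAt (fun z ↦ π γ (F z)) (π γ (Φ τ)) τ :=
      (LinearMap.toContinuousLinearMap (π γ).toLinearMap).hasFDerivAt.comp_hasDerivAt τ (hF τ hτ)
    have hcomp := (hF _ (moebius_mem_UH γ hτ)).scomp τ (hasDerivAt_moebius γ hτ)
    simpa only [hauto γ τ hτ, sub_self, Function.comp_apply] using hcomp.fun_sub hπ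
  exact isOpen_UH.is_const_of_deriv_eq_zero isPreconnected_UH
    (fun τ hτ ↦ (hderiv τ hτ).differentiableAt.differentiableWithinAt)
    (fun τ hτ ↦ (hderiv τ hτ).deriv) h₁ h₂
end

section
/- Let Φ : ℍ → M_n(ℂ) be holomorphic and satisfy the Ad-automorphy law of weight 2 for ρ, and let f : ℍ → GL(n,ℂ) be holomorphic (entrywise) with f′(τ) = Φ(τ)·f(τ) for all τ ∈ ℍ. Then for every γ ∈ Γ the function τ ↦ f(γ·τ)⁻¹·ρ(γ)·f(τ) is constant on ℍ. -/
open Matrix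

theorem moebius_im (γ : Matrix.SpecialLinearGroup (Fin 2) ℝ) (τ : ℂ) :
    (moebius γ τ).im = τ.im / Complex.normSq (denom γ τ) := by
  have hdet := γ.det_coe
  rw [Matrix.det_fin_two] at hdet
  change (_ / denom γ τ).im = _
  rw [Complex.div_im, ← sub_div]
  congr 1
  simp [denom]
  linear_combination τ.im * hdet

/-- If `g` and `h` solve the same linear equation `y' = A y` and `g` is invertible, then `g⁻¹ h`
has zero derivative. -/
theorem hasDerivAt_ringInverse_mul_eq_zero {𝕜 R : Type*} [NontriviallyNormedField 𝕜]
    [NormedRing R] [CompleteSpace R] [NormedAlgebra 𝕜 R] {g h : 𝕜 → R} {A : R} {x : 𝕜}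
    (hg : HasDerivAt g (A * g x) x) (hh : HasDerivAt h (A * h x) x) (hu : IsUnit (g x)) :
    HasDerivAt (fun y => Ring.inverse (g y) * h y) 0 x := by
  obtain ⟨u, hu⟩ := hu
  have hinv : HasFDerivAt Ring.inverse _ (g x) := hu ▸ hasFDerivAt_ringInverse (𝕜 := 𝕜) u
  refine ((hinv.comp_hasDerivAt x hg).mul hh).congr_deriv ?_
  simp [← hu, mul_assoc]

section MatrixNorm

attribute [local instance] Matrix.linftyOpNormedRing Matrix.linftyOpNormedAlgebra

theorem Matrix.hasDerivAt_of_entries {𝕜 m : Type*} [NontriviallyNormedField 𝕜] [Fintype m]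
    [DecidableEq m] {F : 𝕜 → Matrix m m ℂ} [NormedAlgebra 𝕜 ℂ] {F' : Matrix m m ℂ} {x : 𝕜}
    (hF : ∀ i j, HasDerivAt (fun y => F y i j) (F' i j) x) : HasDerivAt F F' x := by
  have hsum (M : Matrix m m ℂ) : M = ∑ i, ∑ j, M i j • Matrix.single i j (1 : ℂ) := by
    conv_lhs => rw [Matrix.matrix_eq_sum_single M]
    simp
  rw [funext fun y => hsum (F y), hsum F']
  exact HasDerivAt.fun_sum fun i _ => HasDerivAt.fun_sum fun j _ => (hF i j).smul_const _

theorem Matrix.inv_mul_eq_of_hasDerivAt {n : ℕ} {s : Set ℂ} (hs : IsOpen s)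
    (hs' : IsPreconnected s) {A g h : ℂ → Matrix (Fin n) (Fin n) ℂ}
    (hg : ∀ τ ∈ s, ∀ i j, HasDerivAt (fun σ => g σ i j) ((A τ * g τ) i j) τ)
    (hh : ∀ τ ∈ s, ∀ i j, HasDerivAt (fun σ => h σ i j) ((A τ * h τ) i j) τ)
    (hu : ∀ τ ∈ s, IsUnit (g τ)) {x y : ℂ} (hx : x ∈ s) (hy : y ∈ s) :
    (g x)⁻¹ * h x = (g y)⁻¹ * h y := by
  have hderiv (τ : ℂ) (hτ : τ ∈ s) :
      HasDerivAt (fun σ => Ring.inverse (g σ) * h σ) 0 τ :=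
    hasDerivAt_ringInverse_mul_eq_zero (Matrix.hasDerivAt_of_entries (hg τ hτ))
      (Matrix.hasDerivAt_of_entries (hh τ hτ)) (hu τ hτ)
  simp only [Matrix.nonsing_inv_eq_ringInverse]
  exact hs.is_const_of_deriv_eq_zero hs'
    (fun τ hτ => (hderiv τ hτ).differentiableAt.differentiableWithinAt)
    (fun τ hτ => (hderiv τ hτ).deriv) hx hy

end MatrixNorm

/-- if `Φ : ℍ → M_n(ℂ)` is holomorphic and satisfies the Ad-automorphy
law of weight 2 for `ρ`, and `f : ℍ → GL(n,ℂ)` is holomorphic (entrywise) with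
`f′ = Φ·f` on `ℍ`, then for every `γ ∈ Γ` the function
`τ ↦ f(γ·τ)⁻¹·ρ(γ)·f(τ)` is constant on `ℍ`. -/
theorem monodromy_conjugation_constant
    {n : ℕ} (hn : 1 ≤ n)
    (Γ : Subgroup (Matrix.SpecialLinearGroup (Fin 2) ℝ))
    (ρ : Γ →* Matrix.GeneralLinearGroup (Fin n) ℂ)
    (Φ f : ℂ → Matrix (Fin n) (Fin n) ℂ)
    (hΦhol : ∀ i j, DifferentiableOn ℂ (fun τ => Φ τ i j) UH)
    (hauto : ∀ γ : Γ, ∀ τ ∈ UH,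
      ((denom ↑γ τ) ^ 2)⁻¹ • Φ (moebius ↑γ τ) = (↑(ρ γ) : Matrix (Fin n) (Fin n) ℂ) * Φ τ * (↑(ρ γ)⁻¹ : Matrix (Fin n) (Fin n) ℂ))
    (hfinv : ∀ τ ∈ UH, IsUnit (f τ))
    (hfderiv : ∀ τ ∈ UH, ∀ i j,
      HasDerivAt (fun σ => f σ i j) ((Φ τ * f τ) i j) τ) :
    ∀ γ : Γ, ∀ τ₁ ∈ UH, ∀ τ₂ ∈ UH,
      (f (moebius ↑γ τ₁))⁻¹ * (↑(ρ γ) : Matrix (Fin n) (Fin n) ℂ) * f τ₁ =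
        (f (moebius ↑γ τ₂))⁻¹ * (↑(ρ γ) : Matrix (Fin n) (Fin n) ℂ) * f τ₂ := by
  intro γ τ₁ hτ₁ τ₂ hτ₂
  rw [Matrix.mul_assoc, Matrix.mul_assoc]
  refine Matrix.inv_mul_eq_of_hasDerivAt isOpen_UH isPreconnected_UH
    (A := fun τ => (↑(ρ γ) : Matrix (Fin n) (Fin n) ℂ) * Φ τ * (↑(ρ γ)⁻¹ : Matrix (Fin n) (Fin n) ℂ))
    (g := fun τ => f (moebius γ τ)) (h := fun τ => (↑(ρ γ) : Matrix (Fin n) (Fin n) ℂ) * f τ)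
    (fun τ hτ i j => ?_) (fun τ hτ i j => ?_)
    (fun τ hτ => hfinv _ (moebius_mem_UH γ hτ)) hτ₁ hτ₂
  · refine ((hfderiv _ (moebius_mem_UH γ hτ) i j).comp τ
      (hasDerivAt_moebius γ hτ)).congr_deriv ?_
    simp only [← hauto γ τ hτ]
    rw [Matrix.smul_mul, Matrix.smul_apply, smul_eq_mul, mul_comm]
  · have hcancel (P : Matrix.GeneralLinearGroup (Fin n) ℂ) (M N : Matrix (Fin n) (Fin n) ℂ) :
        P.val * M * P⁻¹.val * (P.val * N) = P.val * (M * N) := by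
      simp only [mul_assoc, Units.inv_mul_cancel_left]
    simp only [hcancel]
    simp only [Matrix.mul_apply (M := (↑(ρ γ) : Matrix (Fin n) (Fin n) ℂ))]
    exact HasDerivAt.fun_sum fun k _ => (hfderiv τ hτ k j).const_mul _
end

section
/- Let ρ : Γ → GL(n,ℂ) be a homomorphism and Φ : ℍ → M_n(ℂ) holomorphic satisfying the Ad-automorphy law of weight 2 for ρ. Suppose f : ℝ × ℍ → GL(n,ℂ) is smooth (as a function of the three real coordinates) and satisfies: (i) f(0,τ) = I for all τ ∈ ℍ; (ii) for each t, the map τ ↦ f(t,τ) is holomorphic and ∂f/∂τ(t,τ) = t·Φ(τ)·f(t,τ); (iii) for each t there is a homomorphism χ_t : Γ → GL(n,ℂ) with f(t,γ·τ) = ρ(γ)·f(t,τ)·χ_t(γ)⁻¹ for all γ ∈ Γ, τ ∈ ℍ. Then: χ_0 = ρ; for each γ the map t ↦ χ_t(γ) is differentiable at 0; the function E(τ) := (∂f/∂t)(0,τ) is holomorphic on ℍ with E′ = Φ; and E(γ·τ) = ρ(γ)·E(τ)·ρ(γ)⁻¹ + z(γ) for all γ, τ, where z(γ) = −(d/dt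 χ_t(γ))|_{t=0}·ρ(γ)⁻¹. In particular E is an Eichler integral of weight 0 for Ad ρ whose period cocycle equals the infinitesimal deformation cocycle of the family of monodromy representations χ_t. -/
open Matrix

theorem hasDerivAt_matrix_mul_apply {l m n : Type*} [Fintype m]
    {A : ℝ → Matrix l m ℂ} {B : ℝ → Matrix m n ℂ} {A' : Matrix l m ℂ} {B' : Matrix m n ℂ} {t : ℝ}
    (hA : ∀ i j, HasDerivAt (fun s => A s i j) (A' i j) t)
    (hB : ∀ i j, HasDerivAt (fun s => B s i j) (B' i j) t) (i : l) (j : n) :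
    HasDerivAt (fun s => (A s * B s) i j) ((A' * B t + A t * B') i j) t := by
  simp only [Matrix.mul_apply, Matrix.add_apply, ← Finset.sum_add_distrib]
  exact HasDerivAt.fun_sum fun k _ => (hA i k).fun_mul (hB k j)

theorem differentiableAt_matrix_det {m : Type*} [Fintype m] [DecidableEq m]
    {A : ℝ → Matrix m m ℂ} {t : ℝ} (hA : ∀ i j, DifferentiableAt ℝ (fun s => A s i j) t) :
    DifferentiableAt ℝ (fun s => (A s).det) t := by
  simp only [Matrix.det_apply]
  refine DifferentiableAt.fun_sum fun σ _ => ?_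
  simp only [Units.smul_def, zsmul_eq_mul]
  exact (DifferentiableAt.fun_finsetProd fun i _ => hA _ _).const_mul _

theorem differentiableAt_matrix_inv_apply {m : Type*} [Fintype m] [DecidableEq m]
    {A : ℝ → Matrix m m ℂ} {t : ℝ} (hA : ∀ i j, DifferentiableAt ℝ (fun s => A s i j) t)
    (hdet : IsUnit (A t)) (i j : m) :
    DifferentiableAt ℝ (fun s => (A s)⁻¹ i j) t := by
  simp only [Matrix.inv_def, Matrix.smul_apply, Ring.inverse_eq_inv', smul_eq_mul,
    Matrix.adjugate_apply]
  refine ((differentiableAt_matrix_det hA).fun_inv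
    ((Matrix.isUnit_iff_isUnit_det _).mp hdet).ne_zero).fun_mul
    (differentiableAt_matrix_det fun k l => ?_)
  by_cases hk : k = j
  · subst hk
    simp
  · simpa [Matrix.updateRow_ne hk] using hA k l

/-- given a smooth family `f(t,·)` of holomorphic solutions of
`∂f/∂τ = t·Φ·f` with `f(0,·) = I` and monodromy homomorphisms `χ_t`, one has
`χ_0 = ρ`, each `t ↦ χ_t(γ)` is differentiable at `0`, and
`E(τ) := (∂f/∂t)(0,τ)` is an Eichler integral of weight 0 for `Ad ρ` with `E′ = Φ`,
whose period cocycle is `z(γ) = −(d/dt χ_t(γ))|₀·ρ(γ)⁻¹`: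
`E(γ·τ) = ρ(γ)·E(τ)·ρ(γ)⁻¹ + z(γ)`. -/
theorem family_derivative_is_eichler_integral
    {n : ℕ} (hn : 1 ≤ n)
    (Γ : Subgroup (Matrix.SpecialLinearGroup (Fin 2) ℝ))
    (ρ : Γ →* Matrix.GeneralLinearGroup (Fin n) ℂ)
    (Φ : ℂ → Matrix (Fin n) (Fin n) ℂ)
    (hΦhol : ∀ i j, DifferentiableOn ℂ (fun τ => Φ τ i j) UH)
    (hΦauto : ∀ γ : Γ, ∀ τ ∈ UH,
      ((denom ↑γ τ) ^ 2)⁻¹ • Φ (moebius ↑γ τ) =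
        (↑(ρ γ) : Matrix (Fin n) (Fin n) ℂ) * Φ τ *
          (↑(ρ γ)⁻¹ : Matrix (Fin n) (Fin n) ℂ))
    (f : ℝ → ℂ → Matrix (Fin n) (Fin n) ℂ)
    (hfsmooth : ∀ i j,
      ContDiffOn ℝ (⊤ : ℕ∞) (fun p : ℝ × ℂ => f p.1 p.2 i j) (Set.univ ×ˢ UH))
    (hfinv : ∀ t : ℝ, ∀ τ ∈ UH, IsUnit (f t τ))
    (hf0 : ∀ τ ∈ UH, f 0 τ = 1)
    (hfτ : ∀ t : ℝ, ∀ τ ∈ UH, ∀ i j,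
      HasDerivAt (fun σ : ℂ => f t σ i j) ((t • (Φ τ * f t τ)) i j) τ)
    (χ : ℝ → Γ → Matrix.GeneralLinearGroup (Fin n) ℂ)
    (hχhom : ∀ t : ℝ, ∀ γ₁ γ₂ : Γ, χ t (γ₁ * γ₂) = χ t γ₁ * χ t γ₂)
    (hχ : ∀ t : ℝ, ∀ γ : Γ, ∀ τ ∈ UH,
      f t (moebius ↑γ τ) =
        (↑(ρ γ) : Matrix (Fin n) (Fin n) ℂ) * f t τ *
          (↑(χ t γ)⁻¹ : Matrix (Fin n) (Fin n) ℂ)) :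
    (∀ γ : Γ, χ 0 γ = ρ γ) ∧
    ∃ (E : ℂ → Matrix (Fin n) (Fin n) ℂ) (z : Γ → Matrix (Fin n) (Fin n) ℂ),
      (∀ τ ∈ UH, ∀ i j,
        HasDerivAt (fun t : ℝ => f t τ i j) (E τ i j) 0) ∧
      (∀ γ : Γ, ∀ i j,
        HasDerivAt (fun t : ℝ => (↑(χ t γ) : Matrix (Fin n) (Fin n) ℂ) i j)
          ((-(z γ * (↑(ρ γ) : Matrix (Fin n) (Fin n) ℂ))) i j) 0) ∧
      (∀ τ ∈ UH, ∀ i j,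
        HasDerivAt (fun σ : ℂ => E σ i j) (Φ τ i j) τ) ∧
      (∀ γ : Γ, ∀ τ ∈ UH,
        E (moebius ↑γ τ) =
          (↑(ρ γ) : Matrix (Fin n) (Fin n) ℂ) * E τ *
            (↑(ρ γ)⁻¹ : Matrix (Fin n) (Fin n) ℂ) + z γ) := by
  have hmul : ∀ t : ℝ, ∀ γ : Γ, ∀ τ ∈ UH,
      f t (moebius ↑γ τ) * (χ t γ : Matrix (Fin n) (Fin n) ℂ) = (ρ γ).val * f t τ := by
    intro t γ τ hτ
    rw [hχ t γ τ hτ, mul_assoc, Units.inv_mul, mul_one]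
  have hχ0 : ∀ γ : Γ, χ 0 γ = ρ γ := by
    intro γ
    have hI : Complex.I ∈ UH := by simp [UH]
    have h := hmul 0 γ _ hI
    rw [hf0 _ hI, hf0 _ (moebius_mem_UH γ hI), one_mul, mul_one] at h
    exact Units.ext h
  have hnhds : ∀ τ ∈ UH, (Set.univ ×ˢ UH : Set (ℝ × ℂ)) ∈ nhds ((0 : ℝ), τ) := fun τ hτ =>
    prod_mem_nhds Filter.univ_mem (isOpen_UH.mem_nhds hτ)
  have hfd : ∀ τ ∈ UH, ∀ i j, DifferentiableAt ℝ (fun t : ℝ => f t τ i j) 0 := by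
    intro τ hτ i j
    have h := ((hfsmooth i j).contDiffAt (hnhds τ hτ)).differentiableAt (by simp)
    exact h.comp (f := fun t : ℝ => (t, τ)) (0 : ℝ) (by fun_prop)
  let E : ℂ → Matrix (Fin n) (Fin n) ℂ := fun τ => Matrix.of fun i j =>
    deriv (fun t : ℝ => f t τ i j) 0
  have hE : ∀ τ ∈ UH, ∀ i j, HasDerivAt (fun t : ℝ => f t τ i j) (E τ i j) 0 :=
    fun τ hτ i j => (hfd τ hτ i j).hasDerivAt
  have hχd : ∀ γ : Γ, ∀ i j, DifferentiableAt ℝ (fun t : ℝ => (χ t γ).val i j) 0 := by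
    intro γ i j
    have hI : Complex.I ∈ UH := by simp [UH]
    have hγI := moebius_mem_UH γ hI
    have heq : ∀ t, (χ t γ).val = (f t (moebius γ Complex.I))⁻¹ * ((ρ γ).val * f t Complex.I) := by
      intro t
      rw [← hmul t γ _ hI, ← mul_assoc,
        Matrix.nonsing_inv_mul _ ((Matrix.isUnit_iff_isUnit_det _).mp (hfinv t _ hγI)), one_mul]
    simp only [heq]
    have hinv : ∀ i j, HasDerivAt (fun t => (f t (moebius γ Complex.I))⁻¹ i j)
        (deriv (fun t => (f t (moebius γ Complex.I))⁻¹ i j) 0) 0 := fun i j =>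
      (differentiableAt_matrix_inv_apply (hfd _ hγI) (hfinv 0 _ hγI) i j).hasDerivAt
    have hρf := hasDerivAt_matrix_mul_apply (A := fun _ => (ρ γ).val) (A' := 0)
      (fun i j => hasDerivAt_const (0 : ℝ) ((ρ γ).val i j)) (hE _ hI)
    exact (hasDerivAt_matrix_mul_apply (A := fun t => (f t (moebius γ Complex.I))⁻¹)
      (A' := fun i j => deriv (fun t => (f t (moebius γ Complex.I))⁻¹ i j) 0)
      hinv hρf i j).differentiableAt
  let X : Γ → Matrix (Fin n) (Fin n) ℂ := fun γ => Matrix.of fun i j =>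
    deriv (fun t : ℝ => (χ t γ).val i j) 0
  have hX : ∀ γ : Γ, ∀ i j, HasDerivAt (fun t : ℝ => (χ t γ).val i j) (X γ i j) 0 :=
    fun γ i j => (hχd γ i j).hasDerivAt
  have hfcont : ∀ τ ∈ UH, ∀ i j, ContinuousAt (fun p : ℝ × ℂ => f p.1 p.2 i j) (0, τ) :=
    fun τ hτ i j => (hfsmooth i j).continuousOn.continuousAt (hnhds τ hτ)
  refine ⟨hχ0, E, fun γ => -(X γ * ((ρ γ)⁻¹).val), hE, ?_, ?_, ?_⟩
  · intro γ i j
    rw [neg_mul, neg_neg, mul_assoc, Units.inv_mul, mul_one]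
    exact hX γ i j
  · intro τ hτ i j
    refine hasDerivAt_of_tendstoLocallyUniformlyOn (l := nhdsWithin (0 : ℝ) {0}ᶜ)
      (f := fun t σ => t⁻¹ • (f t σ i j - f 0 σ i j)) (f' := fun t σ => (Φ σ * f t σ) i j)
      (g' := fun σ => Φ σ i j) isOpen_UH ?_ ?_ ?_ hτ
    · rw [tendstoLocallyUniformlyOn_iff_forall_tendsto]
      intro σ hσ
      have hΦc : ∀ k l, ContinuousAt (fun σ => Φ σ k l) σ := fun k l =>
        (hΦhol k l).continuousOn.continuousAt (isOpen_UH.mem_nhds hσ)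
      have hF : ContinuousAt (fun p : ℝ × ℂ => (Φ p.2 * f p.1 p.2) i j) (0, σ) := by
        simp only [Matrix.mul_apply]
        exact tendsto_finsetSum _ fun k _ =>
          ((hΦc i k).comp_of_eq continuousAt_snd rfl).mul (hfcont σ hσ k j)
      have hG : ContinuousAt (fun p : ℝ × ℂ => Φ p.2 i j) (0, σ) :=
        (hΦc i j).comp_of_eq continuousAt_snd rfl
      have h := hG.prodMk hF
      unfold ContinuousAt at h
      simp only [hf0 σ hσ, mul_one] at h
      refine (h.mono_right (nhds_le_uniformity _)).mono_left ?_
      rw [nhds_prod_eq]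
      exact Filter.prod_mono nhdsWithin_le_nhds nhdsWithin_le_nhds
    · filter_upwards [self_mem_nhdsWithin] with t ht σ hσ
      have h := ((hfτ t σ hσ i j).sub (hfτ 0 σ hσ i j)).const_smul t⁻¹
      have ht' : t ≠ 0 := ht
      simp only [zero_smul, sub_zero, Matrix.smul_apply] at h
      rw [inv_smul_smul₀ ht'] at h
      exact h
    · intro σ hσ
      have h := (hE σ hσ i j).tendsto_slope_zero
      simpa using h
  · intro γ τ hτ
    have hγτ := moebius_mem_UH γ hτ
    have key : E (moebius γ τ) * (ρ γ).val + X γ = (ρ γ).val * E τ := by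
      ext i j
      have h1 := hasDerivAt_matrix_mul_apply (hE _ hγτ) (hX γ) i j
      have h2 := hasDerivAt_matrix_mul_apply (A := fun _ => (ρ γ).val) (A' := 0)
        (fun i j => hasDerivAt_const _ _) (hE _ hτ) i j
      simp only [hmul _ γ τ hτ] at h1
      have h := h1.unique h2
      simpa [hf0 _ hγτ, hχ0] using h
    rw [← key, add_mul, mul_assoc, Units.mul_inv, mul_one]
    exact (add_neg_cancel_right _ _).symm
end
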